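/- arXiv:2210.03262 — 3 statements merged into one kernel-verified Lean document; each statement's English description precedes it below -/
import Mathlib

section
/- Every 3-coloring of {1, 2, …, 14} contains a monochromatic solution (x, y, z) to x + y = z with x, y, z ∈ {1,…,14}, and there exists a 3-coloring of {1, 2, …, 13} with no such monochromatic solution. Hence R₃(x + y = z) = 14. -/
/-- Does the last entry of the colour list `l` (whose `i`-th entry, counting from `0`, is the colour
of `i + 1`) complete a monochromatic solution? -/
def lastBad (l : List ℕ) (n : ℕ) : Bool :=
  (List.range n).any fun i =>
    Nat.ble (i + 2) n && (Nat.beq (l.getD i 0) (l.getD (n - 2 - i) 0) &&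
      Nat.beq (l.getD (n - 2 - i) 0) (l.getD (n - 1) 0))

/-- Backtracking search: every extension of `l` (of length `n`) by `f` colours is bad. -/
def searchBad : ℕ → ℕ → List ℕ → Bool
  | 0, n, l => lastBad l n
  | f + 1, n, l => lastBad l n ||
      (searchBad f (n + 1) (l ++ [0]) && (searchBad f (n + 1) (l ++ [1]) &&
        searchBad f (n + 1) (l ++ [2])))

theorem lastBad_sound (χ : ℕ → Fin 3) (n : ℕ)
    (h : lastBad ((List.range n).map fun i => (χ (i + 1)).val) n = true) :
    ∃ x y : ℕ, 1 ≤ x ∧ 1 ≤ y ∧ x + y ≤ n ∧ χ x = χ y ∧ χ y = χ (x + y) := by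
  have key : ∀ i, i < n →
      ((List.range n).map fun i => (χ (i + 1)).val).getD i 0 = (χ (i + 1)).val := by
    intro i hi
    simp [List.getD, hi]
  simp only [lastBad, List.any_eq_true, List.mem_range, Bool.and_eq_true, Nat.ble_eq,
    Nat.beq_eq] at h
  obtain ⟨i, hi, h2, h3, h4⟩ := h
  rw [key i hi, key (n - 2 - i) (by omega)] at h3
  rw [key (n - 1) (by omega), key (n - 2 - i) (by omega)] at h4
  refine ⟨i + 1, n - 2 - i + 1, by omega, by omega, by omega, Fin.ext h3, ?_⟩
  have e : i + 1 + (n - 2 - i + 1) = n - 1 + 1 := by omega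
  rw [e]
  exact Fin.ext h4

theorem searchBad_sound (χ : ℕ → Fin 3) (f : ℕ) : ∀ n : ℕ,
    searchBad f n ((List.range n).map fun i => (χ (i + 1)).val) = true →
    ∃ x y : ℕ, 1 ≤ x ∧ 1 ≤ y ∧ x + y ≤ n + f ∧ χ x = χ y ∧ χ y = χ (x + y) := by
  induction f with
  | zero => intro n h; exact lastBad_sound χ n h
  | succ f ih =>
    intro n h
    rw [searchBad, Bool.or_eq_true, Bool.and_eq_true, Bool.and_eq_true] at h
    rcases h with h | ⟨h0, h1, h2⟩
    · obtain ⟨x, y, a, b, c, d⟩ := lastBad_sound χ n h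
      exact ⟨x, y, a, b, by omega, d⟩
    · have := ih (n + 1) (by
        rw [List.range_succ, List.map_append, List.map_singleton]
        have hc : (χ (n + 1)).val = 0 ∨ (χ (n + 1)).val = 1 ∨ (χ (n + 1)).val = 2 := by omega
        rcases hc with hc | hc | hc <;> rw [hc] <;> assumption)
      obtain ⟨x, y, a, b, c, d⟩ := this
      exact ⟨x, y, a, b, by omega, d⟩

theorem searchBad_14 : searchBad 14 0 [] = true := by
  decide +kernel

/-- A good coloring of `{1,…,13}`. -/
def schurColor (n : ℕ) : Fin 3 := [0, 0, 1, 1, 0, 2, 2, 2, 2, 2, 0, 1, 1, 0].getD n 0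

theorem schurColor_good : ∀ x y : Fin 14, 1 ≤ x.val → 1 ≤ y.val → x.val + y.val ≤ 13 →
    ¬ (schurColor x.val = schurColor y.val ∧
      schurColor y.val = schurColor (x.val + y.val)) := by
  decide +kernel

/-- `R₃(x + y = z) = 14`: every 3-coloring of `{1,…,14}` contains a
monochromatic solution to `x + y = z`, and some 3-coloring of `{1,…,13}`
contains none. -/
theorem stmt_7 :
    (∀ χ : ℕ → Fin 3, ∃ x y z : ℕ,
      1 ≤ x ∧ x ≤ 14 ∧ 1 ≤ y ∧ y ≤ 14 ∧ 1 ≤ z ∧ z ≤ 14 ∧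
      x + y = z ∧ χ x = χ y ∧ χ y = χ z) ∧
    (∃ χ : ℕ → Fin 3, ∀ x y z : ℕ,
      1 ≤ x → x ≤ 13 → 1 ≤ y → y ≤ 13 → 1 ≤ z → z ≤ 13 →
      x + y = z → ¬ (χ x = χ y ∧ χ y = χ z)) := by
  constructor
  · intro χ
    obtain ⟨x, y, a, b, c, d, e⟩ := searchBad_sound χ 14 0 searchBad_14
    exact ⟨x, y, x + y, a, by omega, b, by omega, by omega, by omega, rfl, d, e⟩
  · refine ⟨schurColor, ?_⟩
    intro x y z hx hx' hy hy' _ hz' rfl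
    exact schurColor_good ⟨x, by omega⟩ ⟨y, by omega⟩ hx hy hz'
end

section
/- Every 3-coloring of {1, 2, …, 43} contains a monochromatic solution (x, y, z) to x + 2y = z, and there exists a 3-coloring of {1, …, 42} with no monochromatic solution. Hence R₃(x + 2y = z) = 43. -/
/-- Refutation trees: a leaf names a monochromatic solution `(x, y, x + 2y)`, a node
branches on the colour of a number. -/
inductive RTree where
  | l (x y : ℕ) : RTree
  | n (v : ℕ) (a b c : RTree) : RTree

/-- Is `(v, c)` recorded in the partial colouring? -/
def hasCol : List (ℕ × ℕ) → ℕ → ℕ → Bool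
  | [], _, _ => false
  | p :: ps, v, c => (Nat.beq p.1 v && Nat.beq p.2 c) || hasCol ps v c

/-- Check that a tree refutes every extension of the partial colouring. -/
def RTree.check : RTree → List (ℕ × ℕ) → Bool
  | .l x y, s => Nat.ble 1 x && Nat.ble 1 y && Nat.ble (x + 2 * y) 43 &&
      ((hasCol s x 0 && hasCol s y 0 && hasCol s (x + 2 * y) 0) ||
       (hasCol s x 1 && hasCol s y 1 && hasCol s (x + 2 * y) 1) ||
       (hasCol s x 2 && hasCol s y 2 && hasCol s (x + 2 * y) 2))
  | .n v a b c, s => a.check ((v, 0) :: s) && b.check ((v, 1) :: s) && c.check ((v, 2) :: s)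

theorem hasCol_sound (χ : ℕ → Fin 3) (s : List (ℕ × ℕ))
    (hs : ∀ p ∈ s, (χ p.1 : ℕ) = p.2) (v c : ℕ) (h : hasCol s v c = true) :
    (χ v : ℕ) = c := by
  induction s with
  | nil => simp [hasCol] at h
  | cons p ps ih =>
    simp only [hasCol, Bool.or_eq_true, Bool.and_eq_true, Nat.beq_eq] at h
    rcases h with ⟨h1, h2⟩ | h
    · rw [← h1, ← h2]
      exact hs p (by simp)
    · exact ih (fun q hq => hs q (by simp [hq])) h

theorem RTree.sound (χ : ℕ → Fin 3) (t : RTree) : ∀ s : List (ℕ × ℕ),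
    (∀ p ∈ s, (χ p.1 : ℕ) = p.2) → t.check s = true →
    ∃ x y : ℕ, 1 ≤ x ∧ 1 ≤ y ∧ x + 2 * y ≤ 43 ∧ χ x = χ y ∧ χ y = χ (x + 2 * y) := by
  induction t with
  | l x y =>
    intro s hs h
    simp only [RTree.check, Bool.or_eq_true, Bool.and_eq_true, Nat.ble_eq] at h
    obtain ⟨⟨⟨hx, hy⟩, hz⟩, h⟩ := h
    refine ⟨x, y, hx, hy, hz, ?_⟩
    have key := hasCol_sound χ s hs
    rcases h with (⟨⟨h1, h2⟩, h3⟩ | ⟨⟨h1, h2⟩, h3⟩) | ⟨⟨h1, h2⟩, h3⟩ <;>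
    · have k1 := key _ _ h1
      have k2 := key _ _ h2
      have k3 := key _ _ h3
      exact ⟨Fin.ext (by omega), Fin.ext (by omega)⟩
  | n v a b c iha ihb ihc =>
    intro s hs h
    simp only [RTree.check, Bool.and_eq_true] at h
    obtain ⟨⟨h1, h2⟩, h3⟩ := h
    have ext : ∀ k, (χ v : ℕ) = k → ∀ p ∈ (v, k) :: s, (χ p.1 : ℕ) = p.2 := by
      intro k hk p hp
      rcases List.mem_cons.1 hp with rfl | hp
      · exact hk
      · exact hs p hp
    have hlt := (χ v).isLt
    have : (χ v : ℕ) = 0 ∨ (χ v : ℕ) = 1 ∨ (χ v : ℕ) = 2 := by omega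
    rcases this with hv | hv | hv
    · exact iha _ (ext _ hv) h1
    · exact ihb _ (ext _ hv) h2
    · exact ihc _ (ext _ hv) h3

/-- The refutation for colourings in which `1` has colour `0`. -/
def refutation : RTree :=
  .n 9 (.n 7 (.l 7 1) (.n 33 (.n 12 (.l 9 12) (.n 31 (.l 31 1) (.l 7 12) (.n 4 (.l 1 4) (.l 4 4)
  (.n 3 (.l 3 3) (.n 27 (.l 9 9) (.l 3 12) (.n 35 (.l 33 1) (.n 16 (.l 1 16) (.l 3 16) (.n 6 (.n
  2 (.l 2 2) (.l 3 2) (.l 27 2)) (.l 6 3) (.l 4 6))) (.l 27 4))) (.n 11 (.l 11 11) (.n 35 (.l 33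
  1) (.l 11 12) (.n 29 (.n 2 (.l 29 2) (.l 7 2) (.l 31 2)) (.l 7 11) (.l 29 3))) (.l 3 4)))))
  (.n 4 (.l 1 4) (.n 15 (.l 15 9) (.l 7 4) (.n 2 (.n 5 (.l 5 2) (.n 13 (.l 9 2) (.l 5 4) (.n 19
  (.l 1 9) (.l 5 7) (.n 3 (.l 1 1) (.n 11 (.l 11 11) (.l 5 3) (.n 37 (.l 33 2) (.n 16 (.l 1 16)
  (.l 5 16) (.n 35 (.l 33 1) (.n 43 (.n 41 (.l 41 1) (.l 35 3) (.l 19 11)) (.l 35 4) (.l 11 16))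
  (.l 11 12))) (.l 15 11))) (.l 13 3)))) (.l 5 5)) (.n 3 (.l 1 1) (.l 3 2) (.n 18 (.n 6 (.l 6 6)
  (.l 2 2) (.l 3 6)) (.l 4 7) (.l 12 3))) (.n 19 (.l 1 9) (.n 11 (.l 9 1) (.l 11 4) (.l 11 2))
  (.l 15 2)))) (.l 4 4))) (.n 11 (.l 9 1) (.l 11 11) (.n 19 (.l 1 9) (.l 19 7) (.n 4 (.l 1 4)
  (.n 41 (.n 2 (.n 13 (.l 9 2) (.l 7 13) (.n 3 (.l 3 3) (.n 39 (.l 39 1) (.l 33 3) (.l 13 13))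
  (.l 13 3))) (.n 3 (.l 1 1) (.l 3 2) (.n 13 (.n 6 (.l 1 6) (.l 2 2) (.n 15 (.l 15 13) (.l 7 4)
  (.l 3 6))) (.l 7 13) (.l 13 3))) (.n 23 (.l 23 9) (.n 15 (.n 5 (.l 5 5) (.l 23 5) (.n 3 (.l 3
  3) (.n 27 (.l 9 9) (.l 27 3) (.l 5 11)) (.l 5 3))) (.l 15 4) (.l 11 2)) (.l 19 2))) (.l 33 4)
  (.l 19 11)) (.l 11 4)))) (.n 11 (.l 9 1) (.n 4 (.l 1 4) (.n 3 (.l 1 1) (.l 3 4) (.n 19 (.l 1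
  9) (.l 11 4) (.n 27 (.l 9 9) (.n 13 (.n 15 (.l 13 1) (.l 7 4) (.l 3 15)) (.l 13 7) (.l 13 3))
  (.l 27 3)))) (.n 25 (.n 2 (.n 21 (.l 21 2) (.l 7 7) (.n 29 (.l 25 2) (.l 7 11) (.l 21 4))) (.l
  7 2) (.n 8 (.l 9 8) (.n 23 (.l 23 1) (.l 7 8) (.n 27 (.l 25 1) (.l 11 8) (.l 23 2))) (.l 4
  2))) (.l 11 7) (.l 25 4))) (.l 11 11))) (.n 33 (.n 4 (.l 1 4) (.n 12 (.l 9 12) (.l 4 4) (.n 31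
  (.l 31 1) (.n 3 (.l 3 3) (.n 11 (.l 9 1) (.l 3 4) (.n 25 (.n 35 (.l 33 1) (.n 43 (.l 25 9) (.l
  35 4) (.n 16 (.l 1 16) (.l 3 16) (.l 11 16))) (.l 11 12)) (.l 25 3) (.l 11 7))) (.n 27 (.l 9
  9) (.n 19 (.l 1 9) (.l 19 4) (.n 2 (.n 13 (.l 9 2) (.n 5 (.l 5 2) (.l 5 13) (.l 5 7)) (.l 13
  3)) (.l 27 2) (.l 3 2))) (.l 3 12))) (.l 7 12))) (.n 15 (.l 15 9) (.n 12 (.l 9 12) (.n 2 (.n 5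
  (.l 5 2) (.l 5 5) (.n 19 (.l 1 9) (.n 13 (.l 9 2) (.n 37 (.l 33 2) (.l 13 12) (.n 29 (.l 29 2)
  (.n 3 (.l 1 1) (.l 3 13) (.n 43 (.n 11 (.l 9 1) (.n 17 (.l 9 17) (.n 35 (.l 33 1) (.l 11 12)
  (.n 41 (.l 41 1) (.l 17 12) (.l 35 3))) (.l 7 5)) (.l 3 4)) (.l 19 12) (.l 37 3))) (.l 29 4)))
  (.l 5 4)) (.l 5 7))) (.n 16 (.l 1 16) (.l 12 2) (.n 39 (.n 11 (.l 11 11) (.l 11 2) (.n 19 (.l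
  1 19) (.l 15 2) (.l 11 4))) (.l 15 12) (.l 7 16))) (.n 16 (.l 1 16) (.n 3 (.l 1 1) (.n 10 (.n
  21 (.l 1 10) (.l 15 3) (.l 7 7)) (.l 10 3) (.l 2 4)) (.l 3 2)) (.l 2 7))) (.l 4 4)) (.l 7 4)))
  (.n 11 (.l 9 1) (.l 11 11) (.n 4 (.l 1 4) (.n 25 (.n 12 (.l 1 12) (.l 4 4) (.n 2 (.n 29 (.l 25
  2) (.n 21 (.l 21 2) (.l 21 4) (.l 7 7)) (.l 7 11)) (.n 29 (.n 31 (.l 29 1) (.n 10 (.l 9 10)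
  (.l 2 4) (.n 27 (.l 25 1) (.l 27 2) (.l 7 10))) (.l 7 12)) (.l 29 2) (.l 7 11)) (.l 7 2))) (.l
  25 4) (.l 11 7)) (.n 19 (.l 1 9) (.n 3 (.l 1 1) (.n 25 (.n 15 (.n 12 (.l 1 12) (.n 27 (.l 25
  1) (.l 3 12) (.n 13 (.l 13 1) (.l 13 3) (.l 13 7))) (.l 4 4)) (.l 3 15) (.l 7 4)) (.l 19 3)
  (.l 11 7)) (.l 3 4)) (.l 11 4)))) (.n 11 (.l 9 1) (.n 19 (.l 1 9) (.n 4 (.l 1 4) (.l 11 4) (.n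
  41 (.n 2 (.n 13 (.l 9 2) (.n 3 (.l 1 1) (.l 13 3) (.n 39 (.l 39 1) (.l 13 13) (.l 33 3))) (.l
  7 13)) (.n 15 (.n 13 (.l 13 1) (.n 3 (.l 3 3) (.l 13 3) (.n 39 (.l 39 1) (.l 13 13) (.l 33
  3))) (.l 7 13)) (.l 11 2) (.l 7 4)) (.n 3 (.l 3 3) (.n 25 (.n 8 (.l 9 8) (.l 3 8) (.l 4 2))
  (.l 3 11) (.l 25 4)) (.l 3 2))) (.l 19 11) (.l 33 4))) (.l 19 7)) (.l 11 11)))) (.n 3 (.l 1 1)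
  (.l 3 3) (.n 13 (.n 27 (.l 1 13) (.l 9 9) (.n 15 (.l 13 1) (.n 39 (.l 13 13) (.l 9 15) (.n 6
  (.l 1 6) (.n 18 (.n 33 (.n 21 (.n 2 (.n 5 (.l 1 2) (.l 5 5) (.n 37 (.l 1 18) (.n 11 (.l 11 1)
  (.l 15 11) (.l 5 3)) (.l 27 5))) (.l 2 2) (.n 43 (.l 1 21) (.n 31 (.l 31 1) (.l 31 6) (.l 27
  2)) (.l 39 2))) (.l 9 6) (.l 21 3)) (.l 15 9) (.l 33 3)) (.l 6 6) (.l 3 18)) (.l 27 6))) (.n 6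
  (.l 1 6) (.n 21 (.n 2 (.n 5 (.l 1 2) (.n 19 (.l 19 1) (.l 9 5) (.n 4 (.l 13 4) (.n 25 (.l 21
  2) (.n 12 (.n 8 (.l 8 2) (.l 9 8) (.l 3 8)) (.l 4 4) (.l 3 12)) (.l 19 3)) (.l 19 4))) (.l 5
  5)) (.l 2 2) (.n 23 (.l 21 1) (.n 7 (.l 7 7) (.l 9 7) (.l 3 2)) (.l 23 2))) (.l 9 6) (.l 15
  3)) (.l 3 6)))) (.n 33 (.n 35 (.l 33 1) (.l 9 13) (.n 31 (.l 31 1) (.l 13 9) (.n 2 (.n 37 (.l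
  33 2) (.n 29 (.l 29 2) (.n 11 (.l 11 11) (.l 11 13) (.n 4 (.l 2 1) (.l 29 4) (.l 3 4))) (.l 29
  3)) (.l 31 3)) (.l 9 2) (.l 31 2)))) (.n 4 (.n 2 (.l 2 1) (.l 9 2) (.n 6 (.l 4 1) (.n 7 (.n 21
  (.l 7 7) (.l 9 6) (.n 15 (.l 1 7) (.l 15 9) (.l 15 3))) (.l 7 13) (.l 3 2)) (.l 2 2))) (.n 2
  (.n 5 (.l 1 2) (.l 5 4) (.n 11 (.n 15 (.l 11 2) (.l 15 9) (.l 5 5)) (.l 11 11) (.l 5 3))) (.l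
  9 2) (.n 7 (.n 15 (.l 1 7) (.l 15 9) (.n 5 (.l 5 1) (.l 5 4) (.l 5 5))) (.l 7 13) (.l 3 2)))
  (.n 12 (.n 10 (.l 10 1) (.l 13 10) (.l 4 3)) (.l 9 12) (.l 4 4))) (.n 27 (.n 39 (.n 2 (.n 35
  (.l 35 2) (.l 9 13) (.n 41 (.l 39 1) (.n 15 (.n 11 (.l 11 2) (.n 29 (.l 27 1) (.l 11 9) (.l 29
  3)) (.l 11 11)) (.l 15 13) (.l 3 15)) (.l 35 3))) (.l 9 2) (.n 29 (.l 27 1) (.n 37 (.l 37 1)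
  (.n 11 (.n 8 (.l 11 8) (.l 13 8) (.l 2 3)) (.l 11 13) (.l 11 11)) (.l 33 2)) (.l 29 2))) (.l
  13 13) (.l 33 3)) (.l 9 9) (.l 27 3))) (.n 19 (.n 39 (.l 1 19) (.n 21 (.l 19 1) (.l 21 9) (.n
  27 (.n 15 (.n 4 (.l 19 4) (.n 31 (.l 1 15) (.l 31 4) (.n 17 (.l 15 1) (.l 9 4) (.n 2 (.l 15 2)
  (.n 5 (.l 5 5) (.l 5 2) (.l 21 5)) (.l 13 2)))) (.l 13 4)) (.l 9 15) (.l 15 3)) (.l 9 9) (.l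
  21 3))) (.l 13 13)) (.n 5 (.n 7 (.l 5 1) (.n 2 (.l 1 2) (.n 15 (.l 5 5) (.l 15 2) (.n 6 (.n 33
  (.n 21 (.l 21 6) (.l 7 7) (.l 15 3)) (.l 19 7) (.l 3 15)) (.l 2 2) (.l 3 6))) (.n 6 (.n 17 (.l
  5 6) (.n 4 (.l 4 1) (.l 9 4) (.n 21 (.n 11 (.l 11 5) (.n 33 (.l 21 6) (.l 19 7) (.n 41 (.n 39
  (.l 39 1) (.l 17 11) (.l 13 13)) (.l 7 17) (.l 33 4))) (.l 3 4)) (.l 7 7) (.l 13 4))) (.l 13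
  2)) (.l 7 6) (.l 2 2))) (.l 7 3)) (.l 9 5) (.l 3 5)) (.l 13 3)))) (.n 3 (.l 1 1) (.n 13 (.n 27
  (.l 1 13) (.n 15 (.l 13 1) (.n 6 (.l 1 6) (.l 3 6) (.n 21 (.n 2 (.n 5 (.l 1 2) (.l 5 5) (.n 17
  (.l 13 2) (.n 23 (.l 21 1) (.l 17 3) (.l 5 9)) (.l 5 6))) (.n 11 (.l 11 1) (.l 11 2) (.n 23
  (.l 21 1) (.l 23 2) (.l 11 6))) (.l 2 2)) (.l 15 3) (.l 9 6))) (.n 39 (.l 13 13) (.n 33 (.n 6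
  (.l 1 6) (.l 27 6) (.n 21 (.n 2 (.n 5 (.l 1 2) (.n 17 (.l 17 2) (.l 17 5) (.n 29 (.l 29 2) (.l
  29 5) (.l 17 6))) (.l 5 5)) (.n 31 (.l 31 1) (.l 27 2) (.n 43 (.l 1 21) (.l 39 2) (.l 31 6)))
  (.l 2 2)) (.l 21 3) (.l 9 6))) (.l 27 3) (.l 15 9)) (.l 9 15))) (.l 9 9)) (.n 19 (.n 39 (.l 1
  19) (.l 13 13) (.n 21 (.l 19 1) (.n 15 (.n 5 (.l 5 5) (.l 3 5) (.n 17 (.l 15 1) (.n 2 (.l 15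
  2) (.l 17 2) (.l 5 2)) (.l 5 17))) (.l 15 3) (.l 9 15)) (.l 21 9))) (.l 13 3) (.n 5 (.n 7 (.l
  5 1) (.l 7 3) (.n 2 (.l 1 2) (.n 6 (.n 17 (.l 5 6) (.l 13 2) (.n 4 (.l 4 1) (.n 21 (.n 31 (.l
  21 5) (.n 23 (.l 21 1) (.l 23 4) (.l 9 7)) (.l 17 7)) (.l 13 4) (.l 7 7)) (.l 9 4))) (.l 2 2)
  (.l 7 6)) (.n 11 (.l 1 5) (.n 37 (.n 16 (.l 5 16) (.n 35 (.l 35 1) (.l 3 16) (.n 39 (.l 37 1)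
  (.l 13 13) (.l 35 2))) (.l 2 7)) (.l 11 13) (.l 19 9)) (.l 7 2)))) (.l 3 5) (.l 9 5))) (.n 33
  (.n 35 (.l 33 1) (.n 31 (.l 31 1) (.n 2 (.n 29 (.l 29 2) (.l 29 3) (.n 11 (.l 11 11) (.n 5 (.l
  1 2) (.l 5 3) (.n 4 (.l 2 1) (.l 3 4) (.l 5 4))) (.l 11 9))) (.l 31 2) (.l 9 2)) (.l 13 9))
  (.l 9 13)) (.n 39 (.n 27 (.n 2 (.n 31 (.l 27 2) (.n 25 (.l 25 1) (.l 25 3) (.n 43 (.l 39 2)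
  (.n 6 (.l 27 6) (.l 31 6) (.l 13 6)) (.l 25 9))) (.l 13 9)) (.n 29 (.l 27 1) (.l 29 2) (.n 11
  (.n 8 (.l 11 8) (.l 2 3) (.l 13 8)) (.l 11 11) (.l 11 9))) (.l 9 2)) (.l 27 3) (.l 9 9)) (.l
  33 3) (.l 13 13)) (.n 4 (.n 2 (.l 2 1) (.n 12 (.l 4 4) (.n 7 (.n 18 (.l 4 7) (.l 12 3) (.n 6
  (.l 4 1) (.l 6 3) (.l 6 6))) (.l 3 2) (.l 7 13)) (.l 9 12)) (.l 9 2)) (.n 10 (.n 12 (.l 10 1)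
  (.l 4 4) (.l 9 12)) (.l 4 3) (.l 13 10)) (.n 2 (.n 5 (.l 1 2) (.n 15 (.n 11 (.l 11 2) (.l 5 3)
  (.l 11 11)) (.l 5 5) (.l 15 9)) (.l 5 4)) (.n 7 (.n 15 (.l 1 7) (.n 5 (.l 5 1) (.l 5 5) (.l 5
  4)) (.l 15 9)) (.l 3 2) (.l 7 13)) (.l 9 2))))) (.l 3 3))

theorem refutation_check : refutation.check [(1, 0)] = true := by
  decide +kernel

/-- A colouring of `{1, …, 42}` without monochromatic solution. -/
def goodCol (k : ℕ) : Fin 3 :=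
  if k ≤ 2 ∨ k % 8 = 1 ∨ k % 8 = 2 then 0 else if k ≤ 8 ∨ 34 ≤ k then 1 else 2

theorem goodCol_spec : ∀ x y : Fin 43,
    ¬ ((1 ≤ x.val ∧ 1 ≤ y.val ∧ x.val + 2 * y.val ≤ 42) ∧ goodCol x = goodCol y ∧ goodCol y = goodCol (x + 2 * y)) := by
  decide +kernel

/-- `R₃(x + 2y = z) = 43`. -/
theorem stmt_8 :
    (∀ χ : ℕ → Fin 3, ∃ x y z : ℕ,
      1 ≤ x ∧ x ≤ 43 ∧ 1 ≤ y ∧ y ≤ 43 ∧ 1 ≤ z ∧ z ≤ 43 ∧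
      x + 2 * y = z ∧ χ x = χ y ∧ χ y = χ z) ∧
    (∃ χ : ℕ → Fin 3, ∀ x y z : ℕ,
      1 ≤ x → x ≤ 42 → 1 ≤ y → y ≤ 42 → 1 ≤ z → z ≤ 42 →
      x + 2 * y = z → ¬ (χ x = χ y ∧ χ y = χ z)) := by
  constructor
  · intro χ
    -- permute the colours so that `1` gets colour `0`
    obtain ⟨x, y, hx, hy, hz, h1, h2⟩ :=
      RTree.sound (fun k => Equiv.swap (χ 1) 0 (χ k)) refutation [(1, 0)]
        (by simp) refutation_check
    exact ⟨x, y, x + 2 * y, hx, by omega, hy, by omega, by omega, hz, rfl,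
      (Equiv.swap (χ 1) 0).injective h1, (Equiv.swap (χ 1) 0).injective h2⟩
  · refine ⟨goodCol, ?_⟩
    rintro x y z hx _ hy _ _ hz rfl
    exact fun h => goodCol_spec ⟨x, by omega⟩ ⟨y, by omega⟩ ⟨⟨hx, hy, hz⟩, h⟩
end

section
/- There exists a 3-coloring of {1, 2, …, 26} with no monochromatic positive-integer solution to 3(x − y) = z, and every 3-coloring of {1, …, 27} has a monochromatic solution. Hence R₃(3(x−y) = z) = 27 = 3³. -/
/-- `s` contains a solution of `3 (x - y) = z`. -/
def hasSol (s : List ℕ) : Bool :=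
  s.any fun x => s.any fun y => s.any fun z => Nat.beq (3 * x) (3 * y + z)

/-- Backtracking search: assigns the numbers of the list one at a time to the colour classes
`a`, `b`, `c`; returns `true` if every branch ends in a monochromatic solution. -/
def closes : List ℕ → List ℕ → List ℕ → List ℕ → Bool
  | [], _, _, _ => false
  | n :: ns, a, b, c =>
    (hasSol (n :: a) || closes ns (n :: a) b c) &&
    ((hasSol (n :: b) || closes ns a (n :: b) c) &&
     (hasSol (n :: c) || closes ns a b (n :: c)))

/-- Every element of `s` lies in `[1, 27]` and has colour `i`. -/
def Good (χ : ℕ → Fin 3) (i : Fin 3) (s : List ℕ) : Prop :=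
  ∀ n ∈ s, 1 ≤ n ∧ n ≤ 27 ∧ χ n = i

/-- There is a monochromatic solution in `[1, 27]`. -/
def Mono (χ : ℕ → Fin 3) : Prop :=
  ∃ x y z : ℕ, 1 ≤ x ∧ x ≤ 27 ∧ 1 ≤ y ∧ y ≤ 27 ∧ 1 ≤ z ∧ z ≤ 27 ∧
      3 * x = 3 * y + z ∧ χ x = χ y ∧ χ y = χ z

theorem mono_of_hasSol {χ : ℕ → Fin 3} {i : Fin 3} {s : List ℕ} (hs : Good χ i s)
    (h : hasSol s = true) : Mono χ := by
  simp only [hasSol, List.any_eq_true] at h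
  obtain ⟨x, hx, y, hy, z, hz, e⟩ := h
  obtain ⟨x1, x2, x3⟩ := hs x hx
  obtain ⟨y1, y2, y3⟩ := hs y hy
  obtain ⟨z1, z2, z3⟩ := hs z hz
  exact ⟨x, y, z, x1, x2, y1, y2, z1, z2, Nat.eq_of_beq_eq_true e,
    x3.trans y3.symm, y3.trans z3.symm⟩

theorem good_cons {χ : ℕ → Fin 3} {i : Fin 3} {s : List ℕ} {n : ℕ} (hs : Good χ i s)
    (hn : 1 ≤ n ∧ n ≤ 27) (h : χ n = i) : Good χ i (n :: s) := by
  intro m hm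
  rcases List.mem_cons.1 hm with rfl | hm
  · exact ⟨hn.1, hn.2, h⟩
  · exact hs m hm

theorem mono_of_closes {χ : ℕ → Fin 3} (ns : List ℕ) :
    ∀ a b c : List ℕ, (∀ n ∈ ns, 1 ≤ n ∧ n ≤ 27) → Good χ 0 a → Good χ 1 b → Good χ 2 c →
      closes ns a b c = true → Mono χ := by
  induction ns with
  | nil => intro a b c _ _ _ _ h; simp [closes] at h
  | cons n ns ih =>
    intro a b c hns ha hb hc h
    simp only [closes, Bool.and_eq_true, Bool.or_eq_true] at h
    obtain ⟨h0, h1, h2⟩ := h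
    have hn := hns n (by simp)
    have hns' : ∀ m ∈ ns, 1 ≤ m ∧ m ≤ 27 := fun m hm => hns m (by simp [hm])
    have h3 : χ n = 0 ∨ χ n = 1 ∨ χ n = 2 := by
      generalize χ n = k
      revert k
      decide
    rcases h3 with e | e | e
    · have g := good_cons ha hn e
      exact h0.elim (mono_of_hasSol g) (ih _ _ _ hns' g hb hc)
    · have g := good_cons hb hn e
      exact h1.elim (mono_of_hasSol g) (ih _ _ _ hns' ha g hc)
    · have g := good_cons hc hn e
      exact h2.elim (mono_of_hasSol g) (ih _ _ _ hns' ha hb g)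

/-- A branching order that keeps the search small. -/
def order : List ℕ :=
  [6, 8, 12, 9, 18, 2, 3, 27, 5, 11, 21, 14, 15, 17, 10, 7, 26, 24, 19, 4, 16, 1, 25, 20, 13,
    23, 22]

theorem closes_order : closes order [] [] [] = true := by
  decide +kernel

/-- The colouring `v₃(n) mod 3` on `[1, 26]`. -/
def col (n : ℕ) : Fin 3 := if n % 9 = 0 then 2 else if n % 3 = 0 then 1 else 0

theorem col_avoids (x y z : ℕ) (hx : x ≤ 26) (hy : 1 ≤ y) (hz : 1 ≤ z) (hz2 : z ≤ 26)
    (e : 3 * x = 3 * y + z) : ¬ (col x = col y ∧ col y = col z) := by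
  rintro ⟨h1, h2⟩
  simp only [col] at h1 h2
  split_ifs at h1 h2 <;> first | omega | simp at h1 h2


/-- `R₃(3(x - y) = z) = 27`: some 3-coloring of `{1,…,26}` has no
monochromatic solution to `3(x - y) = z`, and every 3-coloring of `{1,…,27}`
has one. -/
theorem stmt_16 :
    (∃ χ : ℕ → Fin 3, ∀ x y z : ℕ,
      1 ≤ x → x ≤ 26 → 1 ≤ y → y ≤ 26 → 1 ≤ z → z ≤ 26 →
      3 * x = 3 * y + z → ¬ (χ x = χ y ∧ χ y = χ z)) ∧
    (∀ χ : ℕ → Fin 3, ∃ x y z : ℕ,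
      1 ≤ x ∧ x ≤ 27 ∧ 1 ≤ y ∧ y ≤ 27 ∧ 1 ≤ z ∧ z ≤ 27 ∧
      3 * x = 3 * y + z ∧ χ x = χ y ∧ χ y = χ z) := by

  refine ⟨⟨col, fun x y z _ hx hy _ hz hz2 e => col_avoids x y z hx hy hz hz2 e⟩, fun χ => ?_⟩
  exact mono_of_closes order [] [] [] (by decide) (by simp [Good]) (by simp [Good])
    (by simp [Good]) closes_order
end
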